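/- For every k ≥ 0, ⟨p_{2k}, y^{2k+1}⟩₁ ≠ 0 and ⟨p_{2k+1}, y^{2k}⟩₁ ≠ 0; equivalently, the normalization constant h_k = ⟨p_{2k}, p_{2k+1}⟩₁ is nonzero. -/

import Mathlib

open MeasureTheory Polynomial

/-- The skew-inner product `⟨f,g⟩₁ = ∬ f(x) g(y) ε(x−y) e^{−V(x)−V(y)} dx dy`. -/
noncomputable def skewInner (V f g : Polynomial ℝ) : ℝ :=
  ∫ p : ℝ × ℝ, f.eval p.1 * g.eval p.2 * Real.sign (p.1 - p.2) *
    Real.exp (-V.eval p.1 - V.eval p.2)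

lemma aux_int_Ioi (V f : ℝ[X]) (hdeg : 2 ≤ V.natDegree) (hlc : 0 < V.leadingCoeff) :
    IntegrableOn (fun x => f.eval x * Real.exp (-V.eval x)) (Set.Ioi 0) := by
  apply integrable_of_isBigO_exp_neg (b := 1) one_pos (by fun_prop)
  have hd : (C 2 * X : ℝ[X]).natDegree < V.natDegree := by
    rw [natDegree_C_mul_X _ two_ne_zero]; omega
  have hV0 : V ≠ 0 := by rintro rfl; simp at hdeg
  have hdd : (C 2 * X : ℝ[X]).degree < V.degree := degree_lt_degree hd
  have h1 : Filter.Tendsto (fun x => (V - C 2 * X).eval x) Filter.atTop Filter.atTop := by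
    apply tendsto_atTop_of_leadingCoeff_nonneg
    · rw [degree_sub_eq_left_of_degree_lt hdd, ← natDegree_pos_iff_degree_pos]; omega
    · rw [leadingCoeff_sub_of_degree_lt hdd]; exact hlc.le
  have h2 := f.tendsto_div_exp_atTop
  have h3 : ∀ᶠ x in Filter.atTop, |f.eval x / Real.exp x| < 1 := by
    have := h2.abs
    rw [abs_zero] at this
    exact this.eventually (gt_mem_nhds one_pos)
  apply Asymptotics.IsBigO.of_bound 1
  filter_upwards [h3, h1.eventually_ge_atTop 0] with x h3 h1
  rw [abs_div, abs_of_pos (Real.exp_pos x), div_lt_one (Real.exp_pos x)] at h3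
  simp only [eval_sub, eval_mul, eval_C, eval_X] at h1
  rw [norm_mul, Real.norm_eq_abs, Real.norm_eq_abs, Real.norm_eq_abs, Real.abs_exp, Real.abs_exp,
    one_mul]
  calc |f.eval x| * Real.exp (-V.eval x) ≤ Real.exp x * Real.exp (-(2*x)) := by
        gcongr; linarith
    _ = Real.exp (-1 * x) := by rw [← Real.exp_add]; ring_nf

lemma aux_int (V f : ℝ[X]) (hEven : Even V.natDegree) (hdeg : 2 ≤ V.natDegree)
    (hlc : 0 < V.leadingCoeff) :
    Integrable (fun x => f.eval x * Real.exp (-V.eval x)) := by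
  have h1 := aux_int_Ioi V f hdeg hlc
  have hn : (V.comp (-X)).natDegree = V.natDegree := by
    rw [natDegree_comp]; simp
  have h2 := aux_int_Ioi (V.comp (-X)) (f.comp (-X)) (by rw [hn]; exact hdeg) (by
    rw [leadingCoeff_comp (by simp)]; simp [hEven.neg_one_pow, hlc])
  have h3 : IntegrableOn (fun x => f.eval x * Real.exp (-V.eval x)) (Set.Iio 0) := by
    simp only [eval_comp, eval_neg, eval_X] at h2
    have := h2.comp_neg
    simpa using this
  rw [← integrableOn_univ, ← Set.Iic_union_Ioi (a := (0:ℝ))]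
  exact IntegrableOn.union ((integrableOn_Iic_iff_integrableOn_Iio enorm_ne_top).2 h3) h1

lemma aux_sign_meas : Measurable Real.sign := by
  unfold Real.sign
  refine Measurable.ite measurableSet_Iio measurable_const ?_
  exact Measurable.ite measurableSet_Ioi measurable_const measurable_const

lemma aux_sign_bd (x : ℝ) : ‖Real.sign x‖ ≤ 1 := by
  rcases Real.sign_apply_eq x with h | h | h <;> simp [h]

lemma aux_int2 (V f g : ℝ[X]) (hEven : Even V.natDegree) (hdeg : 2 ≤ V.natDegree)
    (hlc : 0 < V.leadingCoeff) :
    Integrable (fun p : ℝ × ℝ => f.eval p.1 * g.eval p.2 * Real.sign (p.1 - p.2) *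
      Real.exp (-V.eval p.1 - V.eval p.2)) := by
  have h := (aux_int V f hEven hdeg hlc).mul_prod (aux_int V g hEven hdeg hlc)
  have h2 := h.bdd_mul (c := 1) (f := fun p : ℝ × ℝ => Real.sign (p.1 - p.2))
    (aux_sign_meas.comp (measurable_fst.sub measurable_snd)).aestronglyMeasurable
    (Filter.Eventually.of_forall fun p => aux_sign_bd _)
  refine h2.congr (Filter.Eventually.of_forall fun p => ?_)
  simp only [sub_eq_add_neg, Real.exp_add]
  ring

lemma aux_add (V f g₁ g₂ : ℝ[X]) (hEven : Even V.natDegree) (hdeg : 2 ≤ V.natDegree)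
    (hlc : 0 < V.leadingCoeff) :
    skewInner V f (g₁ + g₂) = skewInner V f g₁ + skewInner V f g₂ := by
  unfold skewInner
  rw [← integral_add (aux_int2 V f g₁ hEven hdeg hlc) (aux_int2 V f g₂ hEven hdeg hlc)]
  congr 1; ext p; simp only [eval_add]; ring

lemma aux_smul (V f g : ℝ[X]) (c : ℝ) :
    skewInner V f (C c * g) = c * skewInner V f g := by
  unfold skewInner
  rw [← integral_const_mul]
  congr 1; ext p; simp only [eval_mul, eval_C]; ring

lemma aux_antisymm (V f g : ℝ[X]) : skewInner V f g = - skewInner V g f := by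
  unfold skewInner
  rw [← integral_neg, Measure.volume_eq_prod, ← integral_prod_swap]
  congr 1; ext p
  simp only [Prod.fst_swap, Prod.snd_swap]
  rw [← neg_sub p.1 p.2, Real.sign_neg, show -V.eval p.2 - V.eval p.1 = -V.eval p.1 - V.eval p.2 by ring]
  ring

lemma aux_orth (V f : ℝ[X]) (hEven : Even V.natDegree) (hdeg : 2 ≤ V.natDegree)
    (hlc : 0 < V.leadingCoeff) (n : ℕ) (h : ∀ j < n, skewInner V f (X ^ j) = 0)
    (g : ℝ[X]) (hg : g.degree < n) : skewInner V f g = 0 := by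
  let L : ℝ[X] →ₗ[ℝ] ℝ :=
    { toFun := skewInner V f
      map_add' := fun a b => aux_add V f a b hEven hdeg hlc
      map_smul' := fun c a => by
        rw [smul_eq_C_mul, aux_smul]; rfl }
  have hL : skewInner V f g = L g := rfl
  rw [hL, as_sum_range_C_mul_X_pow g, map_sum]
  apply Finset.sum_eq_zero
  intro i hi
  by_cases hin : i < n
  · change skewInner V f _ = 0
    rw [aux_smul, h i hin, mul_zero]
  · rw [coeff_eq_zero_of_degree_lt (hg.trans_le (by exact_mod_cast not_lt.1 hin))]
    simp

lemma aux_fubini (V f g : ℝ[X]) (hEven : Even V.natDegree) (hdeg : 2 ≤ V.natDegree)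
    (hlc : 0 < V.leadingCoeff) :
    Integrable (fun y => (∫ x, f.eval x * Real.exp (-V.eval x) * Real.sign (x - y)) *
      (g.eval y * Real.exp (-V.eval y))) ∧
    skewInner V f g = ∫ y, (∫ x, f.eval x * Real.exp (-V.eval x) * Real.sign (x - y)) *
      (g.eval y * Real.exp (-V.eval y)) := by
  have h := aux_int2 V f g hEven hdeg hlc
  have e : ∀ y, (∫ x, f.eval x * Real.exp (-V.eval x) * Real.sign (x - y)) *
      (g.eval y * Real.exp (-V.eval y)) = ∫ x, f.eval x * g.eval y * Real.sign (x - y) *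
      Real.exp (-V.eval x - V.eval y) := by
    intro y
    rw [← integral_mul_const]
    congr 1; ext x
    simp only [sub_eq_add_neg, Real.exp_add]; ring
  simp only [e]
  exact ⟨h.integral_prod_right, integral_prod_symm _ h⟩

lemma aux_deriv (w : ℝ → ℝ) (hw : Integrable w) (hc : Continuous w) (y : ℝ) :
    HasDerivAt (fun y => ∫ x, w x * Real.sign (x - y)) (-2 * w y) y := by
  have e : (fun y => ∫ x, w x * Real.sign (x - y)) =
      fun y => (∫ x, w x) - 2 * ((∫ x in Set.Iic 0, w x) + ∫ x in (0:ℝ)..y, w x) := by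
    ext y
    have h1 : (∫ x in Set.Iic 0, w x) + ∫ x in (0:ℝ)..y, w x = ∫ x in Set.Iic y, w x := by
      have := intervalIntegral.integral_Iic_sub_Iic (a := 0) (b := y) hw.integrableOn hw.integrableOn
      linarith
    have hs : Integrable fun x => w x * Real.sign (x - y) := by
      apply hw.mul_bdd (c := 1)
      · exact (aux_sign_meas.comp (measurable_id.sub_const y)).aestronglyMeasurable
      · exact Filter.Eventually.of_forall fun p => aux_sign_bd _
    rw [h1, ← intervalIntegral.integral_Iic_add_Ioi (b := y) hs.integrableOn hs.integrableOn,
      ← intervalIntegral.integral_Iic_add_Ioi (b := y) (f := w) hw.integrableOn hw.integrableOn]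
    have h2 : ∫ x in Set.Ioi y, w x * Real.sign (x - y) = ∫ x in Set.Ioi y, w x := by
      apply setIntegral_congr_fun measurableSet_Ioi
      intro x hx
      simp [Real.sign_of_pos (sub_pos.2 hx)]
    have h3 : ∫ x in Set.Iic y, w x * Real.sign (x - y) = - ∫ x in Set.Iic y, w x := by
      rw [integral_Iic_eq_integral_Iio, integral_Iic_eq_integral_Iio, ← integral_neg]
      apply setIntegral_congr_fun measurableSet_Iio
      intro x hx
      simp [Real.sign_of_neg (sub_neg.2 hx)]
    rw [h2, h3]; ring
  rw [e]
  have h := intervalIntegral.integral_hasDerivAt_right (hc.intervalIntegrable 0 y)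
    hc.stronglyMeasurable.stronglyMeasurableAtFilter hc.continuousAt
  have := ((h.const_add (∫ x in Set.Iic 0, w x)).const_mul 2).const_sub (∫ x, w x)
  simpa using this

lemma aux_const_sign (F : ℝ → ℝ) (hF : Continuous F) (U : Set ℝ) (hU : U.OrdConnected)
    (h : ∀ x ∈ U, F x ≠ 0) : (∀ x ∈ U, 0 < F x) ∨ (∀ x ∈ U, F x < 0) := by
  by_contra hcon
  push Not at hcon
  obtain ⟨⟨a, ha, ha'⟩, ⟨b, hb, hb'⟩⟩ := hcon
  obtain ⟨c, hc, hc0⟩ := hU.isPreconnected.intermediate_value ha hb hF.continuousOn ⟨ha', hb'⟩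
  exact h c hc hc0

lemma aux_poly (F : ℝ → ℝ) (hF : Continuous F) (S : Finset ℝ) :
    ∀ U : Set ℝ, U.OrdConnected → (∀ s ∈ S, F s = 0) → (∀ x ∈ U, F x = 0 → x ∈ S) →
    ∃ g : ℝ[X], g.natDegree ≤ S.card ∧ (∀ x, g.eval x = 0 → x ∈ S) ∧
      ∀ x ∈ U, 0 ≤ F x * g.eval x := by
  induction S using Finset.induction_on_max with
  | empty =>
    intro U hU _ h
    rcases aux_const_sign F hF U hU (fun x hx h0 => by simpa using h x hx h0) with h | h
    · exact ⟨1, by simp, by simp, fun x hx => by simpa using (h x hx).le⟩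
    · exact ⟨-1, by simp, by simp, fun x hx => by simpa using (h x hx).le⟩
  | insert a S hmax ih =>
    intro U hU hS h
    have haS : a ∉ S := fun h => lt_irrefl _ (hmax a h)
    obtain ⟨g, hg1, hg2, hg3⟩ := ih (U ∩ Set.Iio a) (hU.inter Set.ordConnected_Iio)
      (fun s hs => hS s (Finset.mem_insert_of_mem hs)) (fun x hx h0 => by
        rcases Finset.mem_insert.1 (h x hx.1 h0) with h | h
        · exact absurd h (ne_of_lt hx.2)
        · exact h)
    have ha0 : F a = 0 := hS a (Finset.mem_insert_self _ _)
    rw [Finset.card_insert_of_notMem haS]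
    rcases aux_const_sign (fun x => F x * g.eval x) (by fun_prop) (U ∩ Set.Ioi a)
      (hU.inter Set.ordConnected_Ioi) (fun x hx h0 => by
        have hxS : x ∉ S := fun h => lt_asymm (hmax x h) hx.2
        rcases mul_eq_zero.1 h0 with h0 | h0
        · rcases Finset.mem_insert.1 (h x hx.1 h0) with h | h
          · exact absurd h (ne_of_gt hx.2)
          · exact hxS h
        · exact hxS (hg2 x h0)) with h | h
    · refine ⟨g, by omega, fun x hx => Finset.mem_insert_of_mem (hg2 x hx), fun x hx => ?_⟩
      rcases lt_trichotomy x a with hx' | rfl | hx'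
      · exact hg3 x ⟨hx, hx'⟩
      · simp [ha0]
      · exact (h x ⟨hx, hx'⟩).le
    · refine ⟨g * (C a - X), ?_, fun x hx => ?_, fun x hx => ?_⟩
      · refine natDegree_mul_le.trans (add_le_add hg1 ?_)
        refine (natDegree_sub_le _ _).trans ?_
        simp
      · simp only [eval_mul, eval_sub, eval_C, eval_X, mul_eq_zero] at hx
        rcases hx with hx | hx
        · exact Finset.mem_insert_of_mem (hg2 x hx)
        · rw [show x = a by linarith]; exact Finset.mem_insert_self _ _
      · simp only [eval_mul, eval_sub, eval_C, eval_X, ← mul_assoc]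
        rcases lt_trichotomy x a with hx' | rfl | hx'
        · exact mul_nonneg (hg3 x ⟨hx, hx'⟩) (by linarith)
        · simp
        · exact mul_nonneg_of_nonpos_of_nonpos (h x ⟨hx, hx'⟩).le (by linarith)

lemma aux_rolle (F F' : ℝ → ℝ) (hF : ∀ x, HasDerivAt F (F' x) x) (n : ℕ) (T : Finset ℝ)
    (hT : T.card = n + 1) (h0 : ∀ x ∈ T, F x = 0) :
    ∃ R : Finset ℝ, R.card = n ∧ ∀ x ∈ R, F' x = 0 := by
  let t := T.orderEmbOfFin hT
  have ht : ∀ i, F (t i) = 0 := fun i => h0 _ (T.orderEmbOfFin_mem hT i)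
  have hex : ∀ i : Fin n, ∃ c ∈ Set.Ioo (t i.castSucc) (t i.succ), F' c = 0 := fun i =>
    exists_hasDerivAt_eq_zero (t.strictMono i.castSucc_lt_succ)
      (fun x _ => (hF x).continuousAt.continuousWithinAt) (by rw [ht, ht]) (fun x _ => hF x)
  choose c hc hc0 using hex
  have hmono : StrictMono c := by
    intro i j hij
    refine (hc i).2.trans_le (le_trans (t.monotone ?_) (hc j).1.le)
    rw [Fin.le_def]; simp; exact hij
  refine ⟨Finset.univ.map ⟨c, hmono.injective⟩, by simp, fun x hx => ?_⟩
  simp only [Finset.mem_map, Finset.mem_univ, true_and] at hx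
  obtain ⟨i, rfl⟩ := hx
  exact hc0 i

lemma aux_main (V : ℝ[X]) (hEven : Even V.natDegree) (hdeg : 2 ≤ V.natDegree)
    (hlc : 0 < V.leadingCoeff) (p : ℝ[X]) (hp : p ≠ 0)
    (h : ∀ j < p.natDegree + 2, skewInner V p (X ^ j) = 0) : False := by
  set F : ℝ → ℝ := fun y => ∫ x, p.eval x * Real.exp (-V.eval x) * Real.sign (x - y) with hFdef
  have hFd := aux_deriv (fun x => p.eval x * Real.exp (-V.eval x)) (aux_int V p hEven hdeg hlc)
    (by fun_prop)
  have hFc : Continuous F := continuous_iff_continuousAt.2 fun y => (hFd y).continuousAt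
  have hno : ∀ T : Finset ℝ, T.card = (p.natDegree + 1) + 1 → ¬ ∀ x ∈ T, F x = 0 := by
    intro T hT h0
    obtain ⟨R, hR, hR0⟩ := aux_rolle F _ hFd _ T hT h0
    have hsub : R ⊆ p.roots.toFinset := by
      intro x hx
      have := hR0 x hx
      simp [Real.exp_ne_zero] at this
      simp [hp, this]
    have := (Finset.card_le_card hsub).trans
      ((Multiset.toFinset_card_le _).trans (card_roots' p))
    omega
  have hfin : {x | F x = 0}.Finite := by
    by_contra hinf
    obtain ⟨T, hT, hT2⟩ := Set.Infinite.exists_subset_card_eq hinf ((p.natDegree + 1) + 1)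
    exact hno T hT2 fun x hx => hT hx
  have hcard : hfin.toFinset.card ≤ p.natDegree + 1 := by
    by_contra hlt
    obtain ⟨T, hT, hT2⟩ := Finset.exists_subset_card_eq (n := (p.natDegree + 1) + 1)
      (s := hfin.toFinset) (by omega)
    exact hno T hT2 fun x hx => by simpa using hT hx
  obtain ⟨g, hg1, hg2, hg3⟩ := aux_poly F hFc hfin.toFinset Set.univ Set.ordConnected_univ
    (fun s hs => by simpa using hs) (fun x _ hx => by simpa using hx)
  have hz := aux_orth V p hEven hdeg hlc _ h g (by
    refine degree_le_natDegree.trans_lt ?_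
    exact_mod_cast (by omega : g.natDegree < p.natDegree + 2))
  obtain ⟨hi, he⟩ := aux_fubini V p g hEven hdeg hlc
  rw [hz] at he
  have hnn : 0 ≤ fun y => F y * (g.eval y * Real.exp (-V.eval y)) := fun y => by
    simp only [Pi.zero_apply]
    rw [← mul_assoc]
    exact mul_nonneg (hg3 y trivial) (Real.exp_pos _).le
  have hae := (integral_eq_zero_iff_of_nonneg hnn hi).1 he.symm
  have heq := (Continuous.ae_eq_iff_eq volume (by fun_prop) (by fun_prop)).1 hae
  obtain ⟨x, hx⟩ := hfin.toFinset.exists_notMem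
  have := congrFun heq x
  simp only [Pi.zero_apply, mul_eq_zero, Real.exp_ne_zero, or_false] at this
  rcases this with h | h
  · exact hx (by simpa using h)
  · exact hx (hg2 x h)

/-- For every `k ≥ 0`, `⟨p_{2k}, y^{2k+1}⟩₁ ≠ 0` and `⟨p_{2k+1}, y^{2k}⟩₁ ≠ 0`;
equivalently, the normalization constant `h_k = ⟨p_{2k}, p_{2k+1}⟩₁` is nonzero. -/
theorem normalization_nonzero
    (V : Polynomial ℝ) (hEven : Even V.natDegree) (hdeg : 2 ≤ V.natDegree)
    (hlc : 0 < V.leadingCoeff) (k : ℕ)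
    (p q : Polynomial ℝ)
    (hpm : p.Monic) (hpdeg : p.natDegree = 2 * k)
    (hporth : ∀ j < 2 * k, skewInner V p (X ^ j) = 0)
    (hqm : q.Monic) (hqdeg : q.natDegree = 2 * k + 1) (hqcoeff : q.coeff (2 * k) = 0)
    (hqorth : ∀ j < 2 * k, skewInner V q (X ^ j) = 0) :
    skewInner V p (X ^ (2 * k + 1)) ≠ 0 ∧
    skewInner V q (X ^ (2 * k)) ≠ 0 ∧
    skewInner V p q ≠ 0 := by
  have split : ∀ (f r : ℝ[X]) (n : ℕ), r.Monic → r.natDegree = n →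
      (∀ j < n, skewInner V f (X ^ j) = 0) → skewInner V f r = skewInner V f (X ^ n) := by
    intro f r n hr hn hf
    have hrd : r.degree = n := by rw [degree_eq_natDegree hr.ne_zero, hn]
    have hd : (r - X ^ n).degree < (n : WithBot ℕ) := by
      rw [← hrd]
      apply degree_sub_lt
      · rw [hrd, degree_X_pow]
      · exact hr.ne_zero
      · rw [hr.leadingCoeff, leadingCoeff_X_pow]
    have h1 := aux_orth V f hEven hdeg hlc n hf _ hd
    have h2 := aux_add V f (r - X ^ n) (X ^ n) hEven hdeg hlc
    rw [sub_add_cancel, h1, zero_add] at h2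
    exact h2
  have hpp : skewInner V p p = 0 := by
    have := aux_antisymm V p p
    linarith
  have hp2k : skewInner V p (X ^ (2 * k)) = 0 := by
    rw [← split p p (2 * k) hpm hpdeg hporth, hpp]
  have hp' : ∀ j < 2 * k + 1, skewInner V p (X ^ j) = 0 := by
    intro j hj
    rcases Nat.lt_succ_iff_lt_or_eq.1 hj with h | rfl
    · exact hporth j h
    · exact hp2k
  have main : skewInner V p (X ^ (2 * k + 1)) ≠ 0 := by
    intro h0
    apply aux_main V hEven hdeg hlc p hpm.ne_zero
    intro j hj
    rw [hpdeg] at hj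
    rcases Nat.lt_succ_iff_lt_or_eq.1 hj with h | rfl
    · exact hp' j h
    · exact h0
  have hpq : skewInner V p q ≠ 0 := by
    rw [split p q _ hqm hqdeg hp']; exact main
  refine ⟨main, ?_, hpq⟩
  rw [← split q p _ hpm hpdeg hqorth, aux_antisymm]
  exact neg_ne_zero.2 hpq
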